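/- Let Γ be a connected bipartite δ-regular simple graph with exactly 5 distinct adjacency eigenvalues and diameter 4 such that, for some constant c ≥ 1, every pair of vertices at distance 2 has exactly c common neighbors. Then Γ is distance-regular. -/

import Mathlib

open Finset Polynomial

/-- A connected graph with diameter `D` is distance-regular if for every `i ≤ D` there are
constants `c i`, `a i`, `b i` such that every vertex `v` at distance `i` from a vertex `u`
has exactly `c i` neighbors at distance `i - 1` from `u`, exactly `a i` neighbors at
distance `i` from `u`, and exactly `b i` neighbors at distance `i + 1` from `u`. -/
def IsDistanceRegular {V : Type*} [Fintype V] [DecidableEq V]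
    (G : SimpleGraph V) [DecidableRel G.Adj] (D : ℕ) : Prop :=
  ∀ i : ℕ, i ≤ D → ∃ c a b : ℕ, ∀ u v : V, G.dist u v = i →
    ((G.neighborFinset v).filter (fun w => G.dist u w + 1 = i)).card = c ∧
    ((G.neighborFinset v).filter (fun w => G.dist u w = i)).card = a ∧
    ((G.neighborFinset v).filter (fun w => G.dist u w = i + 1)).card = b

theorem Matrix.mem_spectrum_iff_exists_mulVec_eq_smul {V : Type*} [Fintype V] [DecidableEq V]
    (A : Matrix V V ℝ) (μ : ℝ) :
    μ ∈ spectrum ℝ A ↔ ∃ x : V → ℝ, x ≠ 0 ∧ A.mulVec x = μ • x := by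
  rw [← Matrix.spectrum_toLin', ← Module.End.hasEigenvalue_iff_mem_spectrum]
  constructor
  · intro h
    obtain ⟨x, hx⟩ := h.exists_hasEigenvector
    exact ⟨x, hx.2, by simpa using hx.apply_eq_smul⟩
  · rintro ⟨x, hx0, hx⟩
    refine Module.End.hasEigenvalue_of_hasEigenvector (x := x) ⟨?_, hx0⟩
    rw [Module.End.mem_eigenspace_iff]
    simpa using hx

/-- A real symmetric matrix is annihilated by every polynomial vanishing on its spectrum. -/
theorem Matrix.IsHermitian.aeval_eq_zero_of_eval_spectrum {V : Type*} [Fintype V] [DecidableEq V]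
    {A : Matrix V V ℝ} (hA : A.IsHermitian) (q : ℝ[X])
    (hq : ∀ μ ∈ spectrum ℝ A, q.eval μ = 0) : aeval A q = 0 := by
  rw [← cfc_polynomial q A hA.isSelfAdjoint, cfc_congr (g := fun _ => 0) (fun μ hμ => hq μ hμ)]
  exact cfc_const_zero ℝ A

namespace SimpleGraph

/-- Switching the sign on one part of a bipartition anticommutes with the adjacency matrix. -/
theorem adjMatrix_mulVec_sign_mul {V : Type*} [Fintype V] {G : SimpleGraph V}
    [DecidableRel G.Adj] {f : V → Bool} (hf : ∀ u v, G.Adj u v → f u ≠ f v)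
    (x : V → ℝ) :
    (G.adjMatrix ℝ).mulVec (fun v => (if f v then 1 else -1) * x v) =
      fun v => -((if f v then 1 else -1) * (G.adjMatrix ℝ).mulVec x v) := by
  ext v
  simp only [adjMatrix_mulVec_apply]
  rw [Finset.mul_sum, ← Finset.sum_neg_distrib]
  refine Finset.sum_congr rfl fun w hw => ?_
  have := hf v w (by simpa using hw)
  cases hv : f v <;> cases hw : f w <;> simp_all

theorem even_dist_iff {V : Type*} {G : SimpleGraph V} (hconn : G.Connected) {f : V → Bool}
    (hf : ∀ u v, G.Adj u v → f u ≠ f v) (u v : V) : Even (G.dist u v) ↔ f u = f v := by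
  obtain ⟨p, hp⟩ := hconn.exists_walk_length_eq_dist u v
  rw [← hp, (Coloring.mk f (hf _ _)).even_length_iff_congr p, ← Bool.eq_iff_iff]
  rfl

theorem dist_of_adj {V : Type*} {G : SimpleGraph V} (hconn : G.Connected) {f : V → Bool}
    (hf : ∀ u v, G.Adj u v → f u ≠ f v) (u : V) {v w : V} (h : G.Adj v w) :
    G.dist u w = G.dist u v + 1 ∨ G.dist u w + 1 = G.dist u v := by
  have h1 := even_dist_iff hconn hf u v
  have h2 := even_dist_iff hconn hf u w
  have h3 := hf v w h
  have h4 : G.dist u w ≠ G.dist u v := by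
    intro h
    rw [h] at h2
    cases hu : f u <;> cases hv : f v <;> cases hw : f w <;> simp_all
  have := h.diff_dist_adj (u := u)
  omega

/-- In a bipartite regular graph the numbers `c i` determine the numbers `a i` and `b i`. -/
theorem exists_intersection_numbers {V : Type*} [Fintype V] {G : SimpleGraph V} [DecidableRel G.Adj]
    (hconn : G.Connected) {δ : ℕ}
    (hreg : G.IsRegularOfDegree δ) {f : V → Bool} (hf : ∀ u v, G.Adj u v → f u ≠ f v)
    {i k : ℕ} (hk : ∀ u v : V, G.dist u v = i →
      ((G.neighborFinset v).filter (fun w => G.dist u w + 1 = i)).card = k) :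
    ∃ c a b : ℕ, ∀ u v : V, G.dist u v = i →
      ((G.neighborFinset v).filter (fun w => G.dist u w + 1 = i)).card = c ∧
      ((G.neighborFinset v).filter (fun w => G.dist u w = i)).card = a ∧
      ((G.neighborFinset v).filter (fun w => G.dist u w = i + 1)).card = b := by
  refine ⟨k, 0, δ - k, fun u v huv => ⟨hk u v huv, ?_, ?_⟩⟩
  · rw [Finset.card_eq_zero, Finset.filter_eq_empty_iff]
    intro w hw
    have := dist_of_adj hconn hf u ((mem_neighborFinset G v w).1 hw)
    omega
  · have hsum := Finset.card_filter_add_card_filter_not (s := G.neighborFinset v)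
      (fun w => G.dist u w + 1 = i)
    rw [hk u v huv, card_neighborFinset_eq_degree, hreg v] at hsum
    rw [← hsum, Nat.add_sub_cancel_left]
    congr 1
    refine Finset.filter_congr fun w hw => ?_
    have := dist_of_adj hconn hf u ((mem_neighborFinset G v w).1 hw)
    omega

variable {V : Type*} [Fintype V] [DecidableEq V] {G : SimpleGraph V} [DecidableRel G.Adj]

theorem IsRegularOfDegree.degree_mem_spectrum [Nonempty V] {δ : ℕ}
    (hreg : G.IsRegularOfDegree δ) : (δ : ℝ) ∈ spectrum ℝ (G.adjMatrix ℝ) := by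
  rw [Matrix.mem_spectrum_iff_exists_mulVec_eq_smul]
  refine ⟨fun _ => 1, fun h => ?_, ?_⟩
  · simpa using congrFun h (Classical.arbitrary V)
  · ext v
    simp [adjMatrix_mulVec_apply, hreg v]

theorem neg_mem_spectrum_adjMatrix {f : V → Bool} (hf : ∀ u v, G.Adj u v → f u ≠ f v)
    {μ : ℝ} (hμ : μ ∈ spectrum ℝ (G.adjMatrix ℝ)) : -μ ∈ spectrum ℝ (G.adjMatrix ℝ) := by
  rw [Matrix.mem_spectrum_iff_exists_mulVec_eq_smul] at *
  obtain ⟨x, hx0, hx⟩ := hμ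
  refine ⟨fun v => (if f v then 1 else -1) * x v, fun h => hx0 ?_, ?_⟩
  · ext v
    have := congrFun h v
    cases hv : f v <;> simp_all
  · rw [adjMatrix_mulVec_sign_mul hf, hx]
    ext v
    simp only [Pi.smul_apply, smul_eq_mul]
    ring

theorem eq_of_adjMatrix_mulVec_eq_degree_smul (hconn : G.Connected) {δ : ℕ}
    (hreg : G.IsRegularOfDegree δ) {x : V → ℝ}
    (hx : (G.adjMatrix ℝ).mulVec x = (δ : ℝ) • x) (u v : V) : x u = x v := by
  refine (lapMatrix_mulVec_eq_zero_iff_forall_reachable G).1 ?_ u v (hconn u v)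
  ext w
  have := congrFun hx w
  rw [adjMatrix_mulVec_apply] at this
  rw [lapMatrix_mulVec_apply, this, hreg w]
  simp

theorem eq_on_part_of_adjMatrix_mulVec_mulVec (hconn : G.Connected) {δ : ℕ} (hδ : δ ≠ 0)
    (hreg : G.IsRegularOfDegree δ) {f : V → Bool} (hf : ∀ u v, G.Adj u v → f u ≠ f v)
    {x : V → ℝ}
    (hx : (G.adjMatrix ℝ).mulVec ((G.adjMatrix ℝ).mulVec x) = ((δ : ℝ) ^ 2) • x)
    {u v : V} (huv : f u = f v) : x u = x v := by
  set A := G.adjMatrix ℝ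
  have hy := eq_of_adjMatrix_mulVec_eq_degree_smul hconn hreg
    (x := A.mulVec x + (δ : ℝ) • x) (by
      rw [Matrix.mulVec_add, hx, Matrix.mulVec_smul]; module) u v
  have hz := eq_of_adjMatrix_mulVec_eq_degree_smul hconn hreg
    (x := fun v => (if f v then 1 else -1) * (A.mulVec x - (δ : ℝ) • x) v) (by
      rw [adjMatrix_mulVec_sign_mul hf, Matrix.mulVec_sub, hx, Matrix.mulVec_smul]
      ext w
      simp only [Pi.smul_apply, Pi.sub_apply, smul_eq_mul]
      ring) u v
  have hδ' : (δ : ℝ) ≠ 0 := by exact_mod_cast hδ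
  simp only [huv, Pi.add_apply, Pi.sub_apply, Pi.smul_apply, smul_eq_mul] at hy hz
  have hz' := mul_left_cancel₀ (by split_ifs <;> norm_num) hz
  exact mul_left_cancel₀ hδ' (by linarith)

theorem adjMatrix_mul_self_apply (u w : V) :
    (G.adjMatrix ℝ * G.adjMatrix ℝ) u w = (G.neighborFinset u ∩ G.neighborFinset w).card := by
  rw [adjMatrix_mul_apply]
  simp only [adjMatrix_apply]
  rw [Finset.sum_boole]
  congr 2
  ext x
  simp [adj_comm]

end SimpleGraph

/-- A decreasing sequence with range closed under negation is antisymmetric under reversal. -/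
theorem StrictAnti.apply_rev_eq_neg {n : ℕ} {θ : Fin n → ℝ} (hθ : StrictAnti θ)
    (hneg : ∀ μ ∈ Set.range θ, -μ ∈ Set.range θ) (i : Fin n) : θ i.rev = -θ i := by
  have h1 : StrictMono fun i : Fin n => θ i.rev := fun i j h => hθ (Fin.rev_lt_rev.2 h)
  have h2 : StrictMono fun i => -θ i := fun i j h => neg_lt_neg (hθ h)
  refine congrFun ((h1.range_inj h2).1 ?_) i
  ext μ
  constructor
  · rintro ⟨j, rfl⟩
    obtain ⟨k, hk⟩ := hneg _ ⟨j.rev, rfl⟩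
    exact ⟨k, by simp [hk]⟩
  · rintro ⟨j, rfl⟩
    obtain ⟨k, hk⟩ := hneg _ ⟨j, rfl⟩
    exact ⟨k.rev, by simp [hk]⟩

theorem exists_sq_annihilating {θ : Fin 5 → ℝ} (hrev : ∀ i, θ i.rev = -θ i)
    {d : ℝ} (hd : d ≠ 0) (hmem : d ∈ Set.range θ) :
    ∃ t : ℝ, ∀ μ ∈ Set.range θ, (μ ^ 2 - d ^ 2) * (μ ^ 3 - t * μ) = 0 := by
  have h0 : θ 4 = -θ 0 := hrev 0
  have h1 : θ 3 = -θ 1 := hrev 1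
  have h2 : θ 2 = 0 := by
    have : θ 2 = -θ 2 := hrev 2
    linarith
  obtain ⟨i, rfl⟩ := hmem
  have : θ i ^ 2 = θ 0 ^ 2 ∨ θ i ^ 2 = θ 1 ^ 2 := by
    fin_cases i <;> simp_all
  rcases this with h | h
  · refine ⟨θ 1 ^ 2, ?_⟩
    rintro _ ⟨j, rfl⟩
    rw [h]
    fin_cases j <;> simp [h0, h1, h2] <;> ring_nf <;> simp
  · refine ⟨θ 0 ^ 2, ?_⟩
    rintro _ ⟨j, rfl⟩
    rw [h]
    fin_cases j <;> simp [h0, h1, h2] <;> ring_nf <;> simp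

namespace SimpleGraph

variable {V : Type*} [Fintype V] [DecidableEq V] {G : SimpleGraph V} [DecidableRel G.Adj]

/-- For a connected bipartite regular graph with five eigenvalues, a Hoffman-type identity:
some matrix `A ^ 3 - t A` is constant on pairs of vertices from opposite parts. -/
theorem exists_cube_sub_smul_const (hconn : G.Connected) {δ : ℕ} (hδ : δ ≠ 0)
    (hreg : G.IsRegularOfDegree δ) {f : V → Bool} (hf : ∀ u v, G.Adj u v → f u ≠ f v)
    {θ : Fin 5 → ℝ} (hθ : StrictAnti θ) (hspec : spectrum ℝ (G.adjMatrix ℝ) = Set.range θ) :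
    ∃ t : ℝ, ∀ u v u' v', f u ≠ f v → f u' ≠ f v' →
      (G.adjMatrix ℝ ^ 3 - t • G.adjMatrix ℝ) u v =
        (G.adjMatrix ℝ ^ 3 - t • G.adjMatrix ℝ) u' v' := by
  have := hconn.nonempty
  have hrev := hθ.apply_rev_eq_neg (by
    rw [← hspec]
    exact fun μ => neg_mem_spectrum_adjMatrix hf)
  obtain ⟨t, ht⟩ := exists_sq_annihilating hrev (d := δ) (by exact_mod_cast hδ)
    (hspec ▸ hreg.degree_mem_spectrum)
  refine ⟨t, ?_⟩
  set A := G.adjMatrix ℝ with hA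
  set N := A ^ 3 - t • A with hN
  have hmul : A * (A * N) = ((δ : ℝ) ^ 2) • N := by
    have h := (G.isHermitian_adjMatrix ℝ).aeval_eq_zero_of_eval_spectrum
      ((X ^ 2 - C ((δ : ℝ) ^ 2)) * (X ^ 3 - C t * X)) (by
        intro μ hμ
        simpa using ht μ (hspec ▸ hμ))
    simp only [map_mul, map_sub, map_pow, aeval_X, aeval_C, ← hA, ← Algebra.smul_def,
      ← hN, sub_mul] at h
    rw [← mul_assoc, ← sq, ← sub_eq_zero, ← h, Algebra.smul_def, map_pow]
  have hsymm : ∀ u v, N u v = N v u := by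
    have hAs : A.IsSymm := G.isSymm_adjMatrix
    have : N.IsSymm := (hAs.pow 3).sub (hAs.smul t)
    exact fun u v => this.apply v u
  have hcol : ∀ u u' v, f u = f u' → N u v = N u' v := by
    intro u u' v huu'
    refine eq_on_part_of_adjMatrix_mulVec_mulVec hconn hδ hreg hf (x := fun w => N w v) ?_ huu'
    ext w
    exact congrFun (congrFun hmul w) v
  have hpair : ∀ u v u' v', f u = f u' → f v = f v' → N u v = N u' v' := by
    intro u v u' v' hu hv
    rw [hcol u u' v hu, hsymm, hcol v v' u' hv, hsymm]
  intro u v u' v' h h'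
  by_cases huu' : f u = f u'
  · refine hpair _ _ _ _ huu' ?_
    revert h h' huu'
    cases f u <;> cases f v <;> cases f u' <;> cases f v' <;> simp
  · rw [hsymm u' v']
    refine hpair _ _ _ _ ?_ ?_ <;> revert h h' huu' <;>
      cases f u <;> cases f v <;> cases f u' <;> cases f v' <;> simp

/-- If vertices at distance two have `c` common neighbors, then `(A ^ 3) u v` counts, for `u`, `v`
at distance three, the neighbors of `v` at distance two from `u` with weight `c`. -/
theorem adjMatrix_pow_three_apply_of_dist_eq_three (hconn : G.Connected) {f : V → Bool}
    (hf : ∀ u v, G.Adj u v → f u ≠ f v) {c : ℕ}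
    (hcommon : ∀ u v : V, G.dist u v = 2 →
      (G.neighborFinset u ∩ G.neighborFinset v).card = c)
    {u v : V} (huv : G.dist u v = 3) :
    (G.adjMatrix ℝ ^ 3) u v =
      ((G.neighborFinset v).filter (fun w => G.dist u w + 1 = 3)).card * (c : ℝ) := by
  rw [pow_succ, sq, mul_adjMatrix_apply, ← nsmul_eq_mul, ← Finset.sum_const, Finset.sum_filter]
  refine Finset.sum_congr rfl fun w hw => ?_
  rw [adjMatrix_mul_self_apply]
  split_ifs with h
  · rw [hcommon u w (by omega)]
  · rw [Nat.cast_eq_zero, Finset.card_eq_zero, Finset.eq_empty_iff_forall_notMem]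
    intro x hx
    simp only [Finset.mem_inter, mem_neighborFinset] at hx hw
    have h1 := dist_of_adj hconn hf u hw
    have h2 := dist_of_adj hconn hf u hx.2.symm
    have h3 : G.dist u x = 1 := dist_eq_one_iff_adj.2 hx.1
    omega

end SimpleGraph

/-- A connected bipartite `δ`-regular graph with exactly 5 distinct
adjacency eigenvalues and diameter 4 in which every pair of vertices at distance 2 has
exactly `c` common neighbors (for some constant `c ≥ 1`) is distance-regular. -/
theorem bipartite_fiveEigenvalues_diamFour_distRegular
    {V : Type*} [Fintype V] [DecidableEq V]
    (G : SimpleGraph V) [DecidableRel G.Adj] (hconn : G.Connected)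
    (δ : ℕ) (hreg : G.IsRegularOfDegree δ)
    (hbip : ∃ f : V → Bool, ∀ u v : V, G.Adj u v → f u ≠ f v)
    (θ : Fin 5 → ℝ) (hθ : StrictAnti θ)
    (hspec : spectrum ℝ (G.adjMatrix ℝ) = Set.range θ)
    (hdiam : (∀ u v : V, G.dist u v ≤ 4) ∧ ∃ u v : V, G.dist u v = 4)
    (c : ℕ) (hc : 1 ≤ c)
    (hcommon : ∀ u v : V, G.dist u v = 2 →
      (G.neighborFinset u ∩ G.neighborFinset v).card = c) :
    IsDistanceRegular G 4 := by
  obtain ⟨f, hf⟩ := hbip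
  obtain ⟨hle, p, q, hpq⟩ := hdiam
  have hδ : δ ≠ 0 := by
    rintro rfl
    have hne : p ≠ q := by
      rintro rfl
      simp at hpq
    have : Nontrivial V := ⟨p, q, hne⟩
    have := hconn.preconnected.degree_pos_of_nontrivial p
    rw [hreg p] at this
    omega
  obtain ⟨t, ht⟩ := G.exists_cube_sub_smul_const hconn hδ hreg hf hθ hspec
  intro i hi
  suffices ∃ k : ℕ, ∀ u v : V, G.dist u v = i →
      ((G.neighborFinset v).filter (fun w => G.dist u w + 1 = i)).card = k from
    this.elim fun k hk => G.exists_intersection_numbers hconn hreg hf hk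
  interval_cases i
  · exact ⟨0, fun u v _ => by simp⟩
  · refine ⟨1, fun u v huv => Finset.card_eq_one.2 ⟨u, ?_⟩⟩
    have hadj := SimpleGraph.dist_eq_one_iff_adj.1 huv
    ext w
    simp only [Finset.mem_filter, SimpleGraph.mem_neighborFinset, Nat.add_eq_right,
      hconn.dist_eq_zero_iff, Finset.mem_singleton]
    refine ⟨fun h => h.2.symm, ?_⟩
    rintro rfl
    exact ⟨hadj.symm, rfl⟩
  · refine ⟨c, fun u v huv => ?_⟩
    rw [← hcommon u v huv]
    congr 1
    ext w
    simp [SimpleGraph.dist_eq_one_iff_adj, and_comm]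
  · by_cases hex : ∃ u v, G.dist u v = 3
    · obtain ⟨u₀, v₀, h₀⟩ := hex
      refine ⟨((G.neighborFinset v₀).filter (fun w => G.dist u₀ w + 1 = 3)).card,
        fun u v huv => ?_⟩
      have key : ∀ {u v}, G.dist u v = 3 → f u ≠ f v ∧ G.adjMatrix ℝ u v = 0 := by
        intro u v h
        constructor
        · rw [Ne, ← G.even_dist_iff hconn hf u v, h]
          decide
        · rw [SimpleGraph.adjMatrix_apply, if_neg]
          rw [← SimpleGraph.dist_eq_one_iff_adj]
          omega
      have h := ht u v u₀ v₀ (key huv).1 (key h₀).1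
      simp only [Matrix.sub_apply, Matrix.smul_apply, (key huv).2, (key h₀).2, smul_zero,
        sub_zero, G.adjMatrix_pow_three_apply_of_dist_eq_three hconn hf hcommon huv,
        G.adjMatrix_pow_three_apply_of_dist_eq_three hconn hf hcommon h₀] at h
      have hc' : (c : ℝ) ≠ 0 := by
        rw [Nat.cast_ne_zero]
        omega
      exact_mod_cast mul_right_cancel₀ hc' h
    · exact ⟨0, fun u v huv => (hex ⟨u, v, huv⟩).elim⟩
  · refine ⟨δ, fun u v huv => ?_⟩
    rw [← hreg v, ← G.card_neighborFinset_eq_degree]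
    congr 1
    refine Finset.filter_true_of_mem fun w hw => ?_
    have := G.dist_of_adj hconn hf u ((G.mem_neighborFinset v w).1 hw)
    have := hle u w
    omega
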